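/- Let (γ_n) be a sequence with γ_n > −1/2 such that γ_n/n → c for some c ≥ 0 as n → ∞. Set σ = √(1 + c + √(1+2c)) and ρ = √(1 + c − √(1+2c)). For n ≥ 2, let σ_n^+ denote the largest positive zero, ρ_n^+ the smallest positive zero, σ_n^- the largest negative zero, and ρ_n^- the smallest negative zero of H_n^{(γ_n)}. Then lim_{n→∞} σ_n^+/√n = σ = −lim_{n→∞} ρ_n^- /√n and lim_{n→∞} ρ_n^+/√n = ρ = −lim_{n→∞} σ_n^- /√n. Moreover, the closure of the set ⋃_{n≥1} { x/√n : H_n^{(γ_n)}(x) = 0 } contains the set [−σ, −ρ] ∪ [ρ, σ]. -/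

import Mathlib

open Filter Topology

/-- Generalized binomial coefficient C(t, m) = t(t-1)⋯(t-m+1)/m! for real t. -/
noncomputable def genBinom (t : ℝ) (m : ℕ) : ℝ :=
  (∏ i ∈ Finset.range m, (t - (i : ℝ))) / (Nat.factorial m)

/-- Laguerre polynomial L_n^{(α)}. -/
noncomputable def laguerreL (n : ℕ) (α : ℝ) (x : ℝ) : ℝ :=
  ∑ k ∈ Finset.range (n + 1),
    (-1) ^ k * genBinom ((n : ℝ) + α) (n - k) * x ^ k / (Nat.factorial k)

/-- Generalized Hermite polynomial H_n^{(γ)}: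
`H_{2m}^{(γ)}(x) = (-1)^m 2^{2m} m! L_m^{(γ-1/2)}(x²)` and
`H_{2m+1}^{(γ)}(x) = (-1)^m 2^{2m+1} m! x L_m^{(γ-1/2)}(x²)`. -/
noncomputable def hermiteH (n : ℕ) (γ : ℝ) (x : ℝ) : ℝ :=
  if n % 2 = 0 then
    (-1) ^ (n / 2) * 2 ^ n * (Nat.factorial (n / 2)) * laguerreL (n / 2) (γ - 1/2) (x ^ 2)
  else
    (-1) ^ (n / 2) * 2 ^ n * (Nat.factorial (n / 2)) * x * laguerreL (n / 2) (γ - 1/2) (x ^ 2)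

/-- Number of zeros of H_n^{(γ)} that are ≤ ξ. -/
noncomputable def hermiteM (n : ℕ) (γ ξ : ℝ) : ℕ :=
  {x : ℝ | hermiteH n γ x = 0 ∧ x ≤ ξ}.ncard

open Polynomial in
/-- The Laguerre polynomial `L_m^{(α)}` as an element of `ℝ[X]`. -/
noncomputable def laguerrePoly (m : ℕ) (α : ℝ) : ℝ[X] :=
  ∑ k ∈ Finset.range (m + 1),
    monomial k ((-1) ^ k * genBinom ((m : ℝ) + α) (m - k) / (Nat.factorial k))

theorem laguerrePoly_eval (m : ℕ) (α x : ℝ) :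
    (laguerrePoly m α).eval x = laguerreL m α x := by
  simp only [laguerrePoly, laguerreL, Polynomial.eval_finsetSum, Polynomial.eval_monomial]
  exact Finset.sum_congr rfl fun k _ => by ring

theorem laguerrePoly_coeff (m : ℕ) (α : ℝ) (k : ℕ) :
    (laguerrePoly m α).coeff k = if k ≤ m then
      (-1) ^ k * genBinom ((m : ℝ) + α) (m - k) / (Nat.factorial k) else 0 := by
  simp [laguerrePoly, Polynomial.finsetSum_coeff, Polynomial.coeff_monomial]

theorem genBinom_succ (t : ℝ) (j : ℕ) :
    genBinom t (j + 1) * (j + 1) = genBinom t j * (t - j) := by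
  have : (j.factorial : ℝ) ≠ 0 := by positivity
  have : (j : ℝ) + 1 ≠ 0 := by positivity
  simp only [genBinom, Finset.prod_range_succ, Nat.factorial_succ]
  push_cast
  field_simp

theorem laguerrePoly_coeff_succ (m : ℕ) (α : ℝ) (k : ℕ) :
    ((k : ℝ) + 1) * (k + 1 + α) * (laguerrePoly m α).coeff (k + 1) =
      (k - m) * (laguerrePoly m α).coeff k := by
  simp only [laguerrePoly_coeff]
  rcases lt_trichotomy k m with h | rfl | h
  · obtain ⟨j, rfl⟩ := Nat.exists_eq_add_of_lt h
    have h1 : k + j + 1 - k = j + 1 := by omega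
    have h2 : k + j + 1 - (k + 1) = j := by omega
    rw [if_pos (by omega), if_pos (by omega), h1, h2, Nat.factorial_succ]
    have := genBinom_succ (((k + j + 1 : ℕ) : ℝ) + α) j
    have : (k.factorial : ℝ) ≠ 0 := by positivity
    have : (k : ℝ) + 1 ≠ 0 := by positivity
    push_cast at *
    field_simp
    rw [pow_succ]
    linear_combination (-1 : ℝ) ^ k * (genBinom_succ (k + j + 1 + α) j)
  · simp
  · rw [if_neg (by omega), if_neg (by omega)]; simp

theorem laguerrePoly_ne_zero (m : ℕ) (α : ℝ) : laguerrePoly m α ≠ 0 := by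
  intro h
  have h1 := laguerrePoly_coeff m α m
  have : (m.factorial : ℝ) ≠ 0 := by positivity
  rw [h] at h1
  simp [genBinom] at h1
  exact div_ne_zero (pow_ne_zero _ (by norm_num)) this h1.symm

open Polynomial in
theorem laguerrePoly_ode (m : ℕ) (α : ℝ) :
    X * derivative (derivative (laguerrePoly m α)) +
      (C α + 1 - X) * derivative (laguerrePoly m α) + C (m : ℝ) * laguerrePoly m α = 0 := by
  ext k
  have h := laguerrePoly_coeff_succ m α k
  rcases k with _ | k
  · simp [sub_mul, add_mul, coeff_derivative] at h ⊢
    linear_combination h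
  · simp [sub_mul, add_mul, coeff_derivative] at h ⊢
    linear_combination h

open Polynomial in
theorem laguerrePoly_ode_eval (m : ℕ) (α x : ℝ) :
    x * (derivative (derivative (laguerrePoly m α))).eval x +
      (α + 1 - x) * (derivative (laguerrePoly m α)).eval x +
      m * (laguerrePoly m α).eval x = 0 := by
  simpa using congrArg (Polynomial.eval x) (laguerrePoly_ode m α)

theorem hasDerivAt_rpow_mul_exp (s t : ℝ) {x : ℝ} (hx : 0 < x) :
    HasDerivAt (fun x : ℝ => x ^ s * Real.exp (-t * x))
      (x ^ s * Real.exp (-t * x) * (s / x - t)) x := by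
  have h1 := Real.hasDerivAt_rpow_const (x := x) (p := s) (Or.inl hx.ne')
  have h2 : HasDerivAt (fun x : ℝ => Real.exp (-t * x)) (Real.exp (-t * x) * (-t * 1)) x :=
    ((hasDerivAt_id x).const_mul (-t)).exp
  refine (h1.mul h2).congr_deriv ?_
  rw [Real.rpow_sub_one hx.ne']
  field_simp
  ring

/-- Numerator of the potential in the Liouville normal form of the Laguerre equation. -/
noncomputable def laguerreQ (m : ℕ) (α x : ℝ) : ℝ :=
  -x ^ 2 + (4 * m + 2 * α + 2) * x + (1 - α ^ 2)

open Polynomial in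
/-- In Liouville normal form the Laguerre equation reads `u'' = -(laguerreQ / (4 x²)) u`. -/
theorem laguerre_normal_form (m : ℕ) (α : ℝ) {x : ℝ} (hx : 0 < x) :
    (derivative (derivative (laguerrePoly m α))).eval x =
      -((α + 1) / x - 1) * (derivative (laguerrePoly m α)).eval x
      - (laguerreQ m α x / (4 * x ^ 2) + ((α + 1) / x - 1) ^ 2 / 4 - (α + 1) / x ^ 2 / 2)
        * (laguerrePoly m α).eval x := by
  have h := laguerrePoly_ode_eval m α x
  have hx' := hx.ne'
  simp only [laguerreQ]
  field_simp
  linear_combination (8 * x) * h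

/-- The square of the normalised Laguerre function, `x^{α+1} e^{-x} L_m^{(α)}(x)²`. -/
noncomputable def laguerreSq (m : ℕ) (α x : ℝ) : ℝ :=
  x ^ (α + 1) * Real.exp (-1 * x) * (laguerrePoly m α).eval x ^ 2

theorem continuous_laguerreSq (m : ℕ) {α : ℝ} (hα : -1 < α) : Continuous (laguerreSq m α) := by
  have : Continuous fun x : ℝ => x ^ (α + 1) := Real.continuous_rpow_const (by linarith)
  unfold laguerreSq
  fun_prop

open Polynomial in
theorem convexOn_laguerreSq (m : ℕ) {α : ℝ} (hα : -1 < α) {D : Set ℝ} (hD : Convex ℝ D)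
    (hpos : ∀ x ∈ interior D, 0 < x) (hQ : ∀ x ∈ interior D, laguerreQ m α x ≤ 0) :
    ConvexOn ℝ D (laguerreSq m α) := by
  set P := laguerrePoly m α with hP
  have hG : ∀ x ∈ interior D, HasDerivAt (fun x : ℝ => x ^ (α + 1) * Real.exp (-1 * x))
      (x ^ (α + 1) * Real.exp (-1 * x) * ((α + 1) / x - 1)) x :=
    fun x hx => hasDerivAt_rpow_mul_exp (α + 1) 1 (hpos x hx)
  refine convexOn_of_hasDerivWithinAt2_nonneg hD (continuous_laguerreSq m hα).continuousOn
    (f' := fun x => x ^ (α + 1) * Real.exp (-1 * x) *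
      (((α + 1) / x - 1) * P.eval x ^ 2 + 2 * P.eval x * (derivative P).eval x))
    (f'' := fun x => x ^ (α + 1) * Real.exp (-1 * x) *
      (2 * ((derivative P).eval x + ((α + 1) / x - 1) / 2 * P.eval x) ^ 2
        - laguerreQ m α x / (2 * x ^ 2) * P.eval x ^ 2)) ?_ ?_ ?_
  · intro x hx
    refine (((hG x hx).mul ((P.hasDerivAt x).pow 2)).congr_deriv ?_).hasDerivWithinAt
    push_cast
    simp only [Pi.pow_apply]
    ring
  · intro x hx
    have hx0 : x ≠ 0 := (hpos x hx).ne'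
    have h1 : HasDerivAt (fun x : ℝ => (α + 1) / x - 1) (-(α + 1) / x ^ 2) x := by
      refine (((hasDerivAt_inv hx0).const_mul (α + 1)).sub_const 1).congr_deriv ?_
      field_simp
    have h2 := ((h1.mul ((P.hasDerivAt x).pow 2)).add
      (((P.hasDerivAt x).const_mul 2).mul ((derivative P).hasDerivAt x)))
    refine (((hG x hx).mul h2).congr_deriv ?_).hasDerivWithinAt
    have h3 := laguerre_normal_form m α (hpos x hx)
    rw [← hP] at h3
    simp only [Pi.pow_apply, Pi.mul_apply, Pi.add_apply]
    rw [h3]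
    push_cast
    field_simp
    ring
  · intro x hx
    have hx0 := hpos x hx
    have h1 : laguerreQ m α x / (2 * x ^ 2) * P.eval x ^ 2 ≤ 0 :=
      mul_nonpos_of_nonpos_of_nonneg
        (div_nonpos_of_nonpos_of_nonneg (hQ x hx) (by positivity)) (sq_nonneg _)
    have h2 : 0 ≤ x ^ (α + 1) * Real.exp (-1 * x) := by positivity
    refine mul_nonneg h2 ?_
    nlinarith [sq_nonneg ((derivative P).eval x + ((α + 1) / x - 1) / 2 * P.eval x)]

theorem tendsto_laguerreSq (m : ℕ) (α : ℝ) : Tendsto (laguerreSq m α) atTop (𝓝 0) := by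
  have h1 := tendsto_rpow_mul_exp_neg_mul_atTop_nhds_zero (α + 1) (1 / 2) (by norm_num)
  have h2 := (((laguerrePoly m α) ^ 2).comp (2 * Polynomial.X)).tendsto_div_exp_atTop.comp
    (tendsto_id.atTop_div_const (show (0 : ℝ) < 2 by norm_num))
  have h3 := h1.mul h2
  rw [mul_zero] at h3
  refine h3.congr fun x => ?_
  have h4 : Real.exp (-1 * x) = Real.exp (-(1 / 2) * x) * (Real.exp (x / 2))⁻¹ := by
    rw [← Real.exp_neg, ← Real.exp_add]
    congr 1
    ring
  simp only [laguerreSq, Function.comp, id, h4]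
  simp [mul_div_cancel₀]
  ring

theorem exists_laguerreSq_pos (m : ℕ) (α : ℝ) {s : Set ℝ} (hs : s.Infinite)
    (hpos : ∀ x ∈ s, 0 < x) : ∃ x ∈ s, 0 < laguerreSq m α x := by
  by_contra! h
  refine laguerrePoly_ne_zero m α (Polynomial.eq_zero_of_infinite_isRoot _ (hs.mono ?_))
  intro x hx
  have hx0 := hpos x hx
  have h1 : 0 < x ^ (α + 1) * Real.exp (-1 * x) := by positivity
  have h2 : (laguerrePoly m α).eval x ^ 2 ≤ 0 := by
    by_contra! h3
    exact absurd (h x hx) (not_le.2 (mul_pos h1 h3))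
  exact pow_eq_zero_iff two_ne_zero |>.1 (le_antisymm h2 (sq_nonneg _))

theorem laguerreL_ne_zero_of_forall_ge (m : ℕ) {α : ℝ} (hα : -1 < α) {a : ℝ} (ha : 0 < a)
    (hQ : ∀ x, a < x → laguerreQ m α x ≤ 0) : laguerreL m α a ≠ 0 := by
  rw [← laguerrePoly_eval]
  intro h0
  have hconv := convexOn_laguerreSq m hα (convex_Ici a)
    (by rw [interior_Ici]; exact fun x hx => ha.trans hx) (by rw [interior_Ici]; exact hQ)
  obtain ⟨x, hx, hxpos⟩ := exists_laguerreSq_pos m α (Set.Ioi_infinite a)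
    fun x hx => ha.trans hx
  have hlt := ((tendsto_laguerreSq m α).eventually_lt_const hxpos).and (eventually_ge_atTop x)
  obtain ⟨z, hz, hxz⟩ := hlt.exists
  have h1 := hconv.le_max_of_mem_Icc Set.self_mem_Ici (Set.mem_Ici.2 (hx.le.trans hxz))
    ⟨hx.le, hxz⟩
  have h2 : laguerreSq m α a = 0 := by simp [laguerreSq, h0]
  rw [h2] at h1
  exact absurd h1 (not_le.2 (max_lt hxpos hz))

theorem laguerreL_ne_zero_of_forall_lt (m : ℕ) {α : ℝ} (hα : -1 < α) {a : ℝ} (ha : 0 < a)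
    (hQ : ∀ x, 0 < x → x < a → laguerreQ m α x ≤ 0) : laguerreL m α a ≠ 0 := by
  rw [← laguerrePoly_eval]
  intro h0
  have hconv := convexOn_laguerreSq m hα (convex_Icc 0 a)
    (by rw [interior_Icc]; exact fun x hx => hx.1)
    (by rw [interior_Icc]; exact fun x hx => hQ x hx.1 hx.2)
  obtain ⟨x, hx, hxpos⟩ := exists_laguerreSq_pos m α (Set.Ioo_infinite ha) fun x hx => hx.1
  have h1 := hconv.le_max_of_mem_Icc (Set.left_mem_Icc.2 ha.le) (Set.right_mem_Icc.2 ha.le)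
    ⟨hx.1.le, hx.2.le⟩
  have h2 : laguerreSq m α a = 0 := by simp [laguerreSq, h0]
  have h3 : laguerreSq m α 0 = 0 := by
    simp [laguerreSq, Real.zero_rpow (show α + 1 ≠ 0 by linarith)]
  rw [h2, h3, max_self] at h1
  exact absurd h1 (not_le.2 hxpos)

/-- Sturm comparison with `v'' = -κ² v`. -/
theorem exists_zero_of_sturm {u u' q : ℝ → ℝ} {p κ : ℝ} (hκ : 0 < κ)
    (hu : ∀ x ∈ Set.Icc p (p + Real.pi / κ), HasDerivAt u (u' x) x)
    (hu' : ∀ x ∈ Set.Icc p (p + Real.pi / κ), HasDerivAt u' (-q x * u x) x)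
    (hq : ∀ x ∈ Set.Icc p (p + Real.pi / κ), κ ^ 2 ≤ q x) :
    ∃ x ∈ Set.Icc p (p + Real.pi / κ), u x = 0 := by
  by_contra! hne
  have hL : 0 < Real.pi / κ := div_pos Real.pi_pos hκ
  have hpL : p ≤ p + Real.pi / κ := by linarith
  wlog hpos : 0 < u p generalizing u u'
  · refine this (u := fun x => -u x) (u' := fun x => -u' x) (fun x hx => (hu x hx).neg)
      (fun x hx => ((hu' x hx).neg).congr_deriv (by ring))
      (fun x hx => neg_ne_zero.2 (hne x hx)) ?_
    exact neg_pos.2 (lt_of_le_of_ne (not_lt.1 hpos) (hne p (Set.left_mem_Icc.2 hpL)))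
  have hcont : ContinuousOn u (Set.Icc p (p + Real.pi / κ)) :=
    fun x hx => (hu x hx).continuousAt.continuousWithinAt
  have hall : ∀ x ∈ Set.Icc p (p + Real.pi / κ), 0 < u x := by
    intro x hx
    by_contra! hle
    obtain ⟨z, hz, hz0⟩ := isPreconnected_Icc.intermediate_value hx (Set.left_mem_Icc.2 hpL)
      hcont ⟨hle, hpos.le⟩
    exact hne z hz hz0
  have hs : ∀ x, HasDerivAt (fun x => Real.sin (κ * (x - p))) (Real.cos (κ * (x - p)) * κ) x :=
    fun x => by
      simpa using (((hasDerivAt_id x).sub_const p).const_mul κ).sin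
  have hc : ∀ x, HasDerivAt (fun x => Real.cos (κ * (x - p))) (-Real.sin (κ * (x - p)) * κ) x :=
    fun x => by
      simpa using (((hasDerivAt_id x).sub_const p).const_mul κ).cos
  have hW : ∀ x ∈ Set.Icc p (p + Real.pi / κ), HasDerivAt
      (fun x => u x * (Real.cos (κ * (x - p)) * κ) - u' x * Real.sin (κ * (x - p)))
      ((q x - κ ^ 2) * u x * Real.sin (κ * (x - p))) x := by
    intro x hx
    refine (((hu x hx).mul ((hc x).mul_const κ)).sub ((hu' x hx).mul (hs x))).congr_deriv ?_
    ring
  have hmono := monotoneOn_of_hasDerivWithinAt_nonneg (convex_Icc p (p + Real.pi / κ))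
    (fun x hx => (hW x hx).continuousAt.continuousWithinAt)
    (fun x hx => (hW x (interior_subset hx)).hasDerivWithinAt) (by
      intro x hx
      have hx := interior_subset hx
      have h1 : κ * (x - p) ≤ Real.pi := by
        have : κ * (Real.pi / κ) = Real.pi := by field_simp
        nlinarith [hx.2]
      have h2 := Real.sin_nonneg_of_nonneg_of_le_pi
        (mul_nonneg hκ.le (sub_nonneg.2 hx.1)) h1
      exact mul_nonneg (mul_nonneg (sub_nonneg.2 (hq x hx)) (hall x hx).le) h2)
  have h := hmono (Set.left_mem_Icc.2 hpL) (Set.right_mem_Icc.2 hpL) hpL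
  have hpi : κ * (p + Real.pi / κ - p) = Real.pi := by field_simp; ring
  simp only [hpi, sub_self, mul_zero, Real.cos_zero, Real.sin_zero, Real.cos_pi,
    Real.sin_pi] at h
  nlinarith [mul_pos hpos hκ, mul_pos (hall _ (Set.right_mem_Icc.2 hpL)) hκ]

open Polynomial in
theorem exists_laguerreL_zero (m : ℕ) (α : ℝ) {p κ : ℝ} (hp : 0 < p) (hκ : 0 < κ)
    (hQ : ∀ x ∈ Set.Icc p (p + Real.pi / κ), κ ^ 2 ≤ laguerreQ m α x / (4 * x ^ 2)) :
    ∃ x ∈ Set.Icc p (p + Real.pi / κ), laguerreL m α x = 0 := by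
  set P := laguerrePoly m α with hP
  have hpos : ∀ x ∈ Set.Icc p (p + Real.pi / κ), 0 < x := fun x hx => hp.trans_le hx.1
  obtain ⟨x, hx, hx0⟩ := exists_zero_of_sturm hκ
    (u := fun x => x ^ ((α + 1) / 2) * Real.exp (-(1 / 2) * x) * P.eval x)
    (u' := fun x => x ^ ((α + 1) / 2) * Real.exp (-(1 / 2) * x) *
      (((α + 1) / 2 / x - 1 / 2) * P.eval x + (derivative P).eval x))
    (fun x hx => (((hasDerivAt_rpow_mul_exp _ _ (hpos x hx)).mul (P.hasDerivAt x)).congr_deriv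
      (by ring)))
    (fun x hx => by
      have hx0 : x ≠ 0 := (hpos x hx).ne'
      have h1 : HasDerivAt (fun x : ℝ => (α + 1) / 2 / x - 1 / 2) (-((α + 1) / 2) / x ^ 2) x := by
        refine (((hasDerivAt_inv hx0).const_mul ((α + 1) / 2)).sub_const (1 / 2)).congr_deriv ?_
        field_simp
      refine ((hasDerivAt_rpow_mul_exp _ _ (hpos x hx)).mul
        ((h1.mul (P.hasDerivAt x)).add ((derivative P).hasDerivAt x))).congr_deriv ?_
      have h3 := laguerre_normal_form m α (hpos x hx)
      rw [← hP] at h3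
      simp only [Pi.mul_apply, Pi.add_apply]
      rw [h3]
      field_simp
      ring) hQ
  refine ⟨x, hx, ?_⟩
  have hx1 := hpos x hx
  have : x ^ ((α + 1) / 2) * Real.exp (-(1 / 2) * x) ≠ 0 := by positivity
  rw [← laguerrePoly_eval]
  exact (mul_eq_zero.1 hx0).resolve_left this

theorem hermiteH_eq_zero_iff (n : ℕ) (γ : ℝ) {x : ℝ} (hx : x ≠ 0) :
    hermiteH n γ x = 0 ↔ laguerreL (n / 2) (γ - 1 / 2) (x ^ 2) = 0 := by
  have : ((n / 2).factorial : ℝ) ≠ 0 := by positivity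
  unfold hermiteH
  split_ifs <;> simp [this, hx]

theorem hermiteH_neg_eq_zero_iff (n : ℕ) (γ x : ℝ) :
    hermiteH n γ (-x) = 0 ↔ hermiteH n γ x = 0 := by
  rcases eq_or_ne x 0 with rfl | hx
  · simp
  · rw [hermiteH_eq_zero_iff n γ hx, hermiteH_eq_zero_iff n γ (neg_ne_zero.2 hx), neg_sq]

section Asymptotics

variable {γ : ℕ → ℝ} {c : ℝ}

theorem tendsto_scaled_linear_coeff (hγ : Tendsto (fun n : ℕ => γ n / n) atTop (𝓝 c)) :
    Tendsto (fun n : ℕ => (4 * ((n / 2 : ℕ) : ℝ) + 2 * (γ n - 1 / 2) + 2) / n) atTop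
      (𝓝 (2 + 2 * c)) := by
  have h0 : Tendsto (fun n : ℕ => ((n % 2 : ℕ) : ℝ) / n) atTop (𝓝 0) := by
    refine squeeze_zero (fun n => by positivity) (fun n => ?_) tendsto_one_div_atTop_nhds_zero_nat
    gcongr
    exact_mod_cast Nat.lt_succ_iff.1 (Nat.mod_lt n two_pos)
  have h := (((tendsto_const_nhds (x := (2 : ℝ))).sub (h0.const_mul 2)).add
    (hγ.const_mul 2)).add (tendsto_one_div_atTop_nhds_zero_nat (𝕜 := ℝ))
  rw [mul_zero, sub_zero, add_zero] at h
  refine h.congr' ?_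
  filter_upwards [eventually_ge_atTop 1] with n hn
  have hn' : (n : ℝ) ≠ 0 := by positivity
  have h2 : (2 : ℝ) * ((n / 2 : ℕ) : ℝ) + ((n % 2 : ℕ) : ℝ) = n := by
    exact_mod_cast Nat.div_add_mod n 2
  field_simp
  linear_combination (-2 : ℝ) * h2

theorem tendsto_scaled_const_coeff (hγ : Tendsto (fun n : ℕ => γ n / n) atTop (𝓝 c)) :
    Tendsto (fun n : ℕ => (1 - (γ n - 1 / 2) ^ 2) / (n : ℝ) ^ 2) atTop (𝓝 (-c ^ 2)) := by
  have h0 := tendsto_one_div_atTop_nhds_zero_nat (𝕜 := ℝ)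
  have h := (h0.pow 2).sub ((hγ.sub (h0.const_mul (1 / 2))).pow 2)
  have e : (0 : ℝ) ^ 2 - (c - 1 / 2 * 0) ^ 2 = -c ^ 2 := by ring
  rw [e] at h
  refine h.congr' ?_
  filter_upwards [eventually_ge_atTop 1] with n hn
  have hn' : (n : ℝ) ≠ 0 := by positivity
  field_simp

theorem laguerreQ_scaled (m : ℕ) (α v : ℝ) {n : ℕ} (hn : 1 ≤ n) :
    laguerreQ m α (n * v) = (n : ℝ) ^ 2 *
      (-v ^ 2 + (4 * m + 2 * α + 2) / n * v + (1 - α ^ 2) / (n : ℝ) ^ 2) := by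
  have hn' : (n : ℝ) ≠ 0 := by positivity
  unfold laguerreQ
  field_simp

theorem tendsto_scaled_laguerreQ (hγ : Tendsto (fun n : ℕ => γ n / n) atTop (𝓝 c)) (v : ℝ) :
    Tendsto (fun n : ℕ => -v ^ 2 + (4 * ((n / 2 : ℕ) : ℝ) + 2 * (γ n - 1 / 2) + 2) / n * v +
      (1 - (γ n - 1 / 2) ^ 2) / (n : ℝ) ^ 2) atTop (𝓝 (-v ^ 2 + (2 + 2 * c) * v + -c ^ 2)) :=
  (tendsto_const_nhds.add ((tendsto_scaled_linear_coeff hγ).mul_const v)).add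
    (tendsto_scaled_const_coeff hγ)

theorem eventually_laguerreL_ne_zero_of_ge (hγ0 : ∀ n, γ n > -(1 / 2))
    (hγ : Tendsto (fun n : ℕ => γ n / n) atTop (𝓝 c)) {v : ℝ} (hv : 0 < v) (hvc : 1 + c < v)
    (hq : -v ^ 2 + (2 + 2 * c) * v + -c ^ 2 < 0) :
    ∀ᶠ n : ℕ in atTop, ∀ x, n * v ≤ x → laguerreL (n / 2) (γ n - 1 / 2) x ≠ 0 := by
  filter_upwards [(tendsto_scaled_laguerreQ hγ v).eventually_lt_const hq,
    (tendsto_scaled_linear_coeff hγ).eventually_lt_const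
      (show 2 + 2 * c < 2 * v by linarith), eventually_ge_atTop 1] with n h1 h2 hn x hx
  have hn0 : (0 : ℝ) < n := by positivity
  refine laguerreL_ne_zero_of_forall_ge _ (by linarith [hγ0 n]) ((mul_pos hn0 hv).trans_le hx) ?_
  intro y hy
  obtain ⟨w, rfl⟩ : ∃ w, y = n * w := ⟨y / n, by field_simp⟩
  have hw : v ≤ w := le_of_mul_le_mul_left (hx.trans hy.le) hn0
  rw [laguerreQ_scaled _ _ _ hn]
  refine mul_nonpos_of_nonneg_of_nonpos (by positivity) ?_
  nlinarith

theorem eventually_laguerreL_ne_zero_of_le (hγ0 : ∀ n, γ n > -(1 / 2))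
    (hγ : Tendsto (fun n : ℕ => γ n / n) atTop (𝓝 c)) {v : ℝ} (hvc : v < 1 + c)
    (hq : -v ^ 2 + (2 + 2 * c) * v + -c ^ 2 < 0) :
    ∀ᶠ n : ℕ in atTop, ∀ x, 0 < x → x ≤ n * v → laguerreL (n / 2) (γ n - 1 / 2) x ≠ 0 := by
  filter_upwards [(tendsto_scaled_laguerreQ hγ v).eventually_lt_const hq,
    (tendsto_scaled_linear_coeff hγ).eventually_const_lt
      (show 2 * v < 2 + 2 * c by linarith), eventually_ge_atTop 1] with n h1 h2 hn x hx0 hx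
  have hn0 : (0 : ℝ) < n := by positivity
  refine laguerreL_ne_zero_of_forall_lt _ (by linarith [hγ0 n]) hx0 ?_
  intro y _ hy
  obtain ⟨w, rfl⟩ : ∃ w, y = n * w := ⟨y / n, by field_simp⟩
  have hw : w ≤ v := le_of_mul_le_mul_left (hy.le.trans hx) hn0
  rw [laguerreQ_scaled _ _ _ hn]
  refine mul_nonpos_of_nonneg_of_nonpos (by positivity) ?_
  nlinarith

theorem eventually_exists_laguerreL_zero (hγ : Tendsto (fun n : ℕ => γ n / n) atTop (𝓝 c))
    {v₁ v₂ : ℝ} (hv₁ : 0 < v₁) (hv : v₁ < v₂)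
    (hq₁ : 0 < -v₁ ^ 2 + (2 + 2 * c) * v₁ + -c ^ 2)
    (hq₂ : 0 < -v₂ ^ 2 + (2 + 2 * c) * v₂ + -c ^ 2) :
    ∀ᶠ n : ℕ in atTop, ∃ x, n * v₁ ≤ x ∧ x ≤ n * v₂ ∧
      laguerreL (n / 2) (γ n - 1 / 2) x = 0 := by
  obtain ⟨δ, hδ, hδ'⟩ := exists_between (lt_min hq₁ hq₂)
  have hv₂ : 0 < v₂ := hv₁.trans hv
  have hκ : 0 < Real.sqrt δ / (2 * v₂) := div_pos (Real.sqrt_pos.2 hδ) (by positivity)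
  have hlen : ∀ᶠ n : ℕ in atTop, Real.pi / (Real.sqrt δ / (2 * v₂)) ≤ n * (v₂ - v₁) :=
    (tendsto_natCast_atTop_atTop.atTop_mul_const (sub_pos.2 hv)).eventually_ge_atTop _
  filter_upwards [(tendsto_scaled_laguerreQ hγ v₁).eventually_const_lt
      (hδ'.trans_le (min_le_left _ _)), (tendsto_scaled_laguerreQ hγ v₂).eventually_const_lt
      (hδ'.trans_le (min_le_right _ _)), hlen, eventually_ge_atTop 1] with n h1 h2 h3 hn
  have hn0 : (0 : ℝ) < n := by positivity
  obtain ⟨x, hx, hx0⟩ := exists_laguerreL_zero (n / 2) (γ n - 1 / 2) (mul_pos hn0 hv₁) hκ (by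
    intro x hx
    obtain ⟨w, rfl⟩ : ∃ w, x = n * w := ⟨x / n, by field_simp⟩
    have hw1 : v₁ ≤ w := le_of_mul_le_mul_left hx.1 hn0
    have hw2 : w ≤ v₂ := le_of_mul_le_mul_left (show (n : ℝ) * w ≤ n * v₂ by linarith [hx.2]) hn0
    have hw0 : 0 < w := hv₁.trans_le hw1
    rw [laguerreQ_scaled _ _ _ hn, div_pow, Real.sq_sqrt hδ.le, mul_pow (n : ℝ) w 2,
      mul_left_comm (4 : ℝ), mul_div_mul_left _ _ (by positivity), mul_pow]
    set A := (4 * ((n / 2 : ℕ) : ℝ) + 2 * (γ n - 1 / 2) + 2) / n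
    set B := (1 - (γ n - 1 / 2) ^ 2) / (n : ℝ) ^ 2
    have hδw : δ ≤ -w ^ 2 + A * w + B := by
      have e : (v₂ - v₁) * (-w ^ 2 + A * w + B - δ) =
          (v₂ - w) * (-v₁ ^ 2 + A * v₁ + B - δ) + (w - v₁) * (-v₂ ^ 2 + A * v₂ + B - δ) +
          (v₂ - v₁) * ((w - v₁) * (v₂ - w)) := by ring
      have hnn : 0 ≤ (v₂ - v₁) * (-w ^ 2 + A * w + B - δ) := by
        rw [e]
        have := sub_nonneg.2 hw1
        have := sub_nonneg.2 hw2
        have := sub_nonneg.2 h1.le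
        have := sub_nonneg.2 h2.le
        have := sub_nonneg.2 hv.le
        positivity
      exact sub_nonneg.1 (nonneg_of_mul_nonneg_right hnn (sub_pos.2 hv))
    norm_num only
    gcongr
    linarith)
  exact ⟨x, hx.1, by linarith [hx.2], hx0⟩

theorem eventually_exists_hermiteH_zero (hγ : Tendsto (fun n : ℕ => γ n / n) atTop (𝓝 c))
    {σ ρ : ℝ} (hρ : 0 ≤ ρ) (hsum : σ ^ 2 + ρ ^ 2 = 2 + 2 * c) (hprod : σ ^ 2 * ρ ^ 2 = c ^ 2)
    {a b : ℝ} (ha : ρ < a) (hab : a < b) (hb : b < σ) :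
    ∀ᶠ n : ℕ in atTop, ∃ x, 0 < x ∧ a ≤ x / Real.sqrt n ∧ x / Real.sqrt n ≤ b ∧
      hermiteH n (γ n) x = 0 := by
  have ha0 : 0 < a := hρ.trans_lt ha
  have hpos : ∀ t, ρ < t → t < σ → 0 < -(t ^ 2) ^ 2 + (2 + 2 * c) * t ^ 2 + -c ^ 2 := by
    intro t h1 h2
    have e : -(t ^ 2) ^ 2 + (2 + 2 * c) * t ^ 2 + -c ^ 2 = (t ^ 2 - ρ ^ 2) * (σ ^ 2 - t ^ 2) := by
      rw [← hsum, ← hprod]; ring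
    rw [e]
    exact mul_pos (by nlinarith) (by nlinarith)
  filter_upwards [eventually_exists_laguerreL_zero hγ (pow_pos ha0 2)
    (by nlinarith : a ^ 2 < b ^ 2) (hpos a ha (hab.trans hb)) (hpos b (ha.trans hab) hb),
    eventually_ge_atTop 1] with n ⟨x, h1, h2, h3⟩ hn
  have hn0 : (0 : ℝ) < n := by positivity
  have hs : 0 < Real.sqrt n := Real.sqrt_pos.2 hn0
  have hx : 0 < x := lt_of_lt_of_le (by positivity) h1
  refine ⟨Real.sqrt x, Real.sqrt_pos.2 hx, ?_, ?_, ?_⟩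
  · rw [← Real.sqrt_div' _ hn0.le]
    exact Real.le_sqrt_of_sq_le ((le_div_iff₀ hn0).2 (by linarith))
  · rw [← Real.sqrt_div' _ hn0.le]
    exact (Real.sqrt_le_left (ha0.trans hab).le).2 ((div_le_iff₀ hn0).2 (by linarith))
  · rwa [hermiteH_eq_zero_iff _ _ (Real.sqrt_pos.2 hx).ne', Real.sq_sqrt hx.le]

theorem eventually_hermiteH_zero_lt (hγ0 : ∀ n, γ n > -(1 / 2))
    (hγ : Tendsto (fun n : ℕ => γ n / n) atTop (𝓝 c))
    {σ ρ : ℝ} (hρ : 0 ≤ ρ) (hρσ : ρ < σ) (hsum : σ ^ 2 + ρ ^ 2 = 2 + 2 * c)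
    (hprod : σ ^ 2 * ρ ^ 2 = c ^ 2) {a : ℝ} (ha : σ < a) :
    ∀ᶠ n : ℕ in atTop, ∀ x, 0 < x → hermiteH n (γ n) x = 0 → x / Real.sqrt n < a := by
  have e : -(a ^ 2) ^ 2 + (2 + 2 * c) * a ^ 2 + -c ^ 2 = (a ^ 2 - ρ ^ 2) * (σ ^ 2 - a ^ 2) := by
    rw [← hsum, ← hprod]; ring
  have h1 : 0 < a ^ 2 - ρ ^ 2 := by nlinarith
  have h2 : σ ^ 2 - a ^ 2 < 0 := by nlinarith
  filter_upwards [eventually_laguerreL_ne_zero_of_ge hγ0 hγ (v := a ^ 2) (by nlinarith)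
    (by nlinarith) (e ▸ mul_neg_of_pos_of_neg h1 h2), eventually_ge_atTop 1] with n h hn x hx hx0
  have hs : 0 < Real.sqrt n := Real.sqrt_pos.2 (by positivity)
  by_contra! hle
  rw [le_div_iff₀ hs] at hle
  refine h (x ^ 2) ?_ ((hermiteH_eq_zero_iff _ _ hx.ne').1 hx0)
  have := pow_le_pow_left₀ (by nlinarith) hle 2
  rwa [mul_pow, Real.sq_sqrt (Nat.cast_nonneg n), mul_comm] at this

theorem eventually_lt_hermiteH_zero (hγ0 : ∀ n, γ n > -(1 / 2))
    (hγ : Tendsto (fun n : ℕ => γ n / n) atTop (𝓝 c))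
    {σ ρ : ℝ} (hρσ : ρ < σ) (hsum : σ ^ 2 + ρ ^ 2 = 2 + 2 * c)
    (hprod : σ ^ 2 * ρ ^ 2 = c ^ 2) {a : ℝ} (ha : a < ρ) :
    ∀ᶠ n : ℕ in atTop, ∀ x, 0 < x → hermiteH n (γ n) x = 0 → a < x / Real.sqrt n := by
  rcases lt_or_ge a 0 with ha0 | ha0
  · exact Eventually.of_forall fun n x hx _ => ha0.trans_le (by positivity)
  have e : -(a ^ 2) ^ 2 + (2 + 2 * c) * a ^ 2 + -c ^ 2 = (a ^ 2 - ρ ^ 2) * (σ ^ 2 - a ^ 2) := by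
    rw [← hsum, ← hprod]; ring
  have h1 : a ^ 2 - ρ ^ 2 < 0 := by nlinarith
  have h2 : 0 < σ ^ 2 - a ^ 2 := by nlinarith
  filter_upwards [eventually_laguerreL_ne_zero_of_le hγ0 hγ (v := a ^ 2)
    (by nlinarith) (e ▸ mul_neg_of_neg_of_pos h1 h2), eventually_ge_atTop 1] with n h hn x hx hx0
  have hs : 0 < Real.sqrt n := Real.sqrt_pos.2 (by positivity)
  by_contra! hle
  rw [div_le_iff₀ hs] at hle
  refine h (x ^ 2) (by positivity) ?_ ((hermiteH_eq_zero_iff _ _ hx.ne').1 hx0)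
  have := pow_le_pow_left₀ hx.le hle 2
  rwa [mul_pow, Real.sq_sqrt (Nat.cast_nonneg n), mul_comm] at this

end Asymptotics

theorem stmt15 (γ : ℕ → ℝ) (c : ℝ) (hc : 0 ≤ c)
    (hγ : ∀ n, γ n > -(1/2))
    (hγlim : Tendsto (fun n : ℕ => γ n / n) atTop (𝓝 c))
    (σ ρ : ℝ)
    (hσ : σ = Real.sqrt (1 + c + Real.sqrt (1 + 2 * c)))
    (hρ : ρ = Real.sqrt (1 + c - Real.sqrt (1 + 2 * c)))
    (σp ρp σm ρm : ℕ → ℝ)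
    (hσp : ∀ n : ℕ, 2 ≤ n →
      IsGreatest {x : ℝ | hermiteH n (γ n) x = 0 ∧ 0 < x} (σp n))
    (hρp : ∀ n : ℕ, 2 ≤ n →
      IsLeast {x : ℝ | hermiteH n (γ n) x = 0 ∧ 0 < x} (ρp n))
    (hσm : ∀ n : ℕ, 2 ≤ n →
      IsGreatest {x : ℝ | hermiteH n (γ n) x = 0 ∧ x < 0} (σm n))
    (hρm : ∀ n : ℕ, 2 ≤ n →
      IsLeast {x : ℝ | hermiteH n (γ n) x = 0 ∧ x < 0} (ρm n)) :
    Tendsto (fun n : ℕ => σp n / Real.sqrt n) atTop (𝓝 σ) ∧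
    Tendsto (fun n : ℕ => ρm n / Real.sqrt n) atTop (𝓝 (-σ)) ∧
    Tendsto (fun n : ℕ => ρp n / Real.sqrt n) atTop (𝓝 ρ) ∧
    Tendsto (fun n : ℕ => σm n / Real.sqrt n) atTop (𝓝 (-ρ)) ∧
    Set.Icc (-σ) (-ρ) ∪ Set.Icc ρ σ ⊆
      closure (⋃ n : ℕ, ⋃ _ : 1 ≤ n,
        (fun x => x / Real.sqrt n) '' {x : ℝ | hermiteH n (γ n) x = 0}) := by
  set r := Real.sqrt (1 + 2 * c) with hr
  have hr2 : r ^ 2 = 1 + 2 * c := Real.sq_sqrt (by linarith)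
  have hr0 : 0 < r := Real.sqrt_pos.2 (by linarith)
  have hrc : r ≤ 1 + c := Real.sqrt_le_iff.2 ⟨by linarith, by nlinarith⟩
  have hσ2 : σ ^ 2 = 1 + c + r := by rw [hσ, Real.sq_sqrt (by linarith)]
  have hρ2 : ρ ^ 2 = 1 + c - r := by rw [hρ, Real.sq_sqrt (by linarith)]
  have hρ0 : 0 ≤ ρ := hρ ▸ Real.sqrt_nonneg _
  have hρσ : ρ < σ := by
    rw [hρ, hσ]
    exact Real.sqrt_lt_sqrt (by linarith) (by linarith)
  have hsum : σ ^ 2 + ρ ^ 2 = 2 + 2 * c := by rw [hσ2, hρ2]; ring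
  have hprod : σ ^ 2 * ρ ^ 2 = c ^ 2 := by rw [hσ2, hρ2]; linear_combination -hr2
  have hσlim : Tendsto (fun n : ℕ => σp n / Real.sqrt n) atTop (𝓝 σ) := by
    refine tendsto_order.2 ⟨fun a ha => ?_, fun a ha => ?_⟩
    · obtain ⟨a', ha', hσ'⟩ := exists_between (max_lt ha hρσ)
      obtain ⟨b', hb', hσ''⟩ := exists_between hσ'
      filter_upwards [eventually_exists_hermiteH_zero hγlim hρ0 hsum hprod
        ((le_max_right _ _).trans_lt ha') hb' hσ'', eventually_ge_atTop 2]
        with n ⟨x, hx, hax, _, hx0⟩ hn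
      calc a < a' := (le_max_left _ _).trans_lt ha'
        _ ≤ x / Real.sqrt n := hax
        _ ≤ σp n / Real.sqrt n := by gcongr; exact (hσp n hn).2 ⟨hx0, hx⟩
    · filter_upwards [eventually_hermiteH_zero_lt hγ hγlim hρ0 hρσ hsum hprod ha,
        eventually_ge_atTop 2] with n h hn
      exact h _ (hσp n hn).1.2 (hσp n hn).1.1
  have hρlim : Tendsto (fun n : ℕ => ρp n / Real.sqrt n) atTop (𝓝 ρ) := by
    refine tendsto_order.2 ⟨fun a ha => ?_, fun a ha => ?_⟩
    · filter_upwards [eventually_lt_hermiteH_zero hγ hγlim hρσ hsum hprod ha,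
        eventually_ge_atTop 2] with n h hn
      exact h _ (hρp n hn).1.2 (hρp n hn).1.1
    · obtain ⟨b', hb', hbm⟩ := exists_between (lt_min ha hρσ)
      obtain ⟨a', ha', hab'⟩ := exists_between hb'
      filter_upwards [eventually_exists_hermiteH_zero hγlim hρ0 hsum hprod
        ha' hab' (hbm.trans_le (min_le_right _ _)), eventually_ge_atTop 2]
        with n ⟨x, hx, _, hxb, hx0⟩ hn
      calc ρp n / Real.sqrt n ≤ x / Real.sqrt n := by gcongr; exact (hρp n hn).2 ⟨hx0, hx⟩
        _ ≤ b' := hxb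
        _ < a := hbm.trans_le (min_le_left _ _)
  refine ⟨hσlim, hσlim.neg.congr' ?_, hρlim, hρlim.neg.congr' ?_, ?_⟩
  · filter_upwards [eventually_ge_atTop 2] with n hn
    have h : IsLeast {x : ℝ | hermiteH n (γ n) x = 0 ∧ x < 0} (-σp n) := by
      refine ⟨⟨(hermiteH_neg_eq_zero_iff _ _ _).2 (hσp n hn).1.1, neg_neg_of_pos (hσp n hn).1.2⟩,
        fun x hx => ?_⟩
      exact neg_le.1 ((hσp n hn).2 ⟨(hermiteH_neg_eq_zero_iff _ _ _).2 hx.1, neg_pos.2 hx.2⟩)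
    rw [(hρm n hn).unique h, neg_div]
  · filter_upwards [eventually_ge_atTop 2] with n hn
    have h : IsGreatest {x : ℝ | hermiteH n (γ n) x = 0 ∧ x < 0} (-ρp n) := by
      refine ⟨⟨(hermiteH_neg_eq_zero_iff _ _ _).2 (hρp n hn).1.1, neg_neg_of_pos (hρp n hn).1.2⟩,
        fun x hx => ?_⟩
      exact le_neg.1 ((hρp n hn).2 ⟨(hermiteH_neg_eq_zero_iff _ _ _).2 hx.1, neg_pos.2 hx.2⟩)
    rw [(hσm n hn).unique h, neg_div]
  · set S := ⋃ n : ℕ, ⋃ _ : 1 ≤ n,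
      (fun x => x / Real.sqrt n) '' {x : ℝ | hermiteH n (γ n) x = 0} with hS
    have hnegS : ∀ y ∈ S, -y ∈ S := by
      intro y hy
      simp only [hS, Set.mem_iUnion, Set.mem_image, Set.mem_ofPred_eq] at hy ⊢
      obtain ⟨n, hn, x, hx, rfl⟩ := hy
      exact ⟨n, hn, -x, (hermiteH_neg_eq_zero_iff _ _ _).2 hx, neg_div _ _⟩
    have hpos : Set.Icc ρ σ ⊆ closure S := by
      rw [← closure_Ioo hρσ.ne]
      refine closure_minimal (fun s hs => Metric.mem_closure_iff.2 fun ε hε => ?_) isClosed_closure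
      obtain ⟨b, hsb, hb⟩ := exists_between (lt_min (lt_add_of_pos_right s hε) hs.2)
      obtain ⟨n, ⟨x, _, hsx, hxb, hx0⟩, hn⟩ :=
        ((eventually_exists_hermiteH_zero hγlim hρ0 hsum hprod hs.1 hsb
          (hb.trans_le (min_le_right _ _))).and (eventually_ge_atTop 1)).exists
      refine ⟨x / Real.sqrt n, Set.mem_iUnion₂.2 ⟨n, hn, x, hx0, rfl⟩, ?_⟩
      rw [dist_comm, Real.dist_eq, abs_of_nonneg (by linarith)]
      linarith [min_le_left (s + ε) σ]
    refine Set.union_subset (fun y hy => ?_) hpos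
    have h := hpos (a := -y) ⟨le_neg.1 hy.2, neg_le.1 hy.1⟩
    simpa using map_mem_closure continuous_neg h hnegS
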